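/- Define F(x) = ∑_{n≥1} ∑_{m=0}^{n−1} 1/((n+1/2)(m+1/2)) · Γ(1/2+m−x)·Γ(1/2+n+x) / ( Γ(3/2+n−x)·Γ(3/2+m+x) ), which converges for Re(x) < 1/2. Then for all x with Re(x) < 1/2, x ≠ 0, and x+1/2 not a nonpositive integer, F(x) = (γ + 2·log 2 + ψ(1/2+x))/(2x³) − ψ′(1/2+x)/(4x²) + 3π²/(8x²) − π·tan(πx)/(2x³) + π²·tan²(πx)/(4x²). -/

import Mathlib

/-- The generating function
`F(x) = ∑_{n≥1} ∑_{m=0}^{n−1} 1/((n+1/2)(m+1/2)) · Γ(1/2+m−x) Γ(1/2+n+x) /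
(Γ(3/2+n−x) Γ(3/2+m+x))` of the interpolated multiple t values `t^{1/2}(2,{1}^k,2)`
(the `n = 0` term of the outer sum is an empty sum, so it contributes `0`). -/
noncomputable def Fgen (x : ℂ) : ℂ :=
  ∑' n : ℕ, ∑ m ∈ Finset.range n,
    1 / (((n : ℂ) + 1/2) * ((m : ℂ) + 1/2)) *
      (Complex.Gamma (1/2 + (m : ℂ) - x) * Complex.Gamma (1/2 + (n : ℂ) + x)) /
      (Complex.Gamma (3/2 + (n : ℂ) - x) * Complex.Gamma (3/2 + (m : ℂ) + x))

/-- The digamma function `ψ(z) = Γ′(z)/Γ(z)`. -/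
noncomputable def digammaC (z : ℂ) : ℂ := deriv Complex.Gamma z / Complex.Gamma z

/-- The trigamma function `ψ′(z)`, the derivative of the digamma function. -/
noncomputable def trigammaC (z : ℂ) : ℂ := deriv digammaC z

namespace FG

/-- half-integers -/
noncomputable def sh (n : ℕ) : ℂ := (n : ℂ) + 1/2

noncomputable def W (x : ℂ) : ℕ → ℂ
  | 0 => 0
  | n+1 => (sh n + x) / (sh n - x) * W x n + 1 / (sh n * (sh n - x))

noncomputable def FP (x : ℂ) (N : ℕ) : ℂ := ∑ n ∈ Finset.range N, W x n / (sh n * (sh n - x))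
noncomputable def GP (x : ℂ) (N : ℕ) : ℂ :=
  ∑ n ∈ Finset.range N, 1 / (4 * sh n ^ 2 * (sh n - x) ^ 2)

lemma sh_ne (n : ℕ) : sh n ≠ 0 := by
  intro h
  have := congrArg Complex.re h
  simp [sh] at this
  have h2 : (0:ℝ) ≤ n := n.cast_nonneg
  linarith

lemma sh_sub_ne {x : ℂ} (hx : x.re < 1/2) (n : ℕ) : sh n - x ≠ 0 := by
  intro h
  have := congrArg Complex.re h
  simp [sh] at this
  have h2 : (0:ℝ) ≤ n := n.cast_nonneg
  linarith

lemma sh_succ (n : ℕ) : sh (n+1) = sh n + 1 := by simp [sh]; ring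

lemma cast_eq (n : ℕ) : (n : ℂ) = sh n - 1/2 := by simp [sh]

lemma one_sub_ne {x : ℂ} (hx : x.re < 1/2) : 1 - 2 * x ≠ 0 := by
  have := sh_sub_ne hx 0
  intro h
  apply this
  simp [sh]
  linear_combination h / 2

lemma star {x : ℂ} (hx : x.re < 1/2) (n : ℕ) :
    x^2 * W x n + (sh n + x - 1) * (sh n - x) * W (x-1) n = n / (1 - 2*x) := by
  induction n with
  | zero => simp [W]
  | succ n ih =>
    have h1 := sh_sub_ne hx n
    have h2 : sh n - (x - 1) ≠ 0 := sh_sub_ne (by simp; linarith) n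
    have h0 := sh_ne n
    have h3 := one_sub_ne hx
    have e : W (x-1) (n+1) * (sh n - (x-1)) = (sh n + (x-1)) * W (x-1) n + 1 / sh n := by
      simp only [W]; field_simp
    have e' : W x (n+1) * (sh n - x) = (sh n + x) * W x n + 1 / sh n := by
      simp only [W]; field_simp
    rw [sh_succ]
    push_cast
    rw [cast_eq] at ih ⊢
    rw [eq_div_iff h3] at ih ⊢
    apply mul_right_cancel₀ h1
    have e0 : 1 / sh n * sh n = 1 := by field_simp
    generalize 1 / sh n = q at *
    linear_combination (sh n + x) * ih + (1-2*x) * x^2 * e' + (1-2*x) * (sh n + x) * (sh n - x) * e + (1-2*x) * sh n * e0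

lemma fin_rec {x : ℂ} (hx : x.re < 1/2) (N : ℕ) :
    x^2 * (FP x N - GP x N) - (x-1)^2 * (FP (x-1) N - GP (x-1) N) =
     (1 / (1-2*x)) * (N * W (x-1) N - 1/(1-2*x)) + 1 / (4 * (sh N - x)^2) := by
  induction N with
  | zero =>
    have h3 := one_sub_ne hx
    have h1 := sh_sub_ne hx 0
    simp [FP, GP, W, sh] at h1 ⊢
    field_simp
    ring
  | succ n ih =>
    have h1 := sh_sub_ne hx n
    have h2 : sh n - (x - 1) ≠ 0 := sh_sub_ne (by simp; linarith) n
    have h4 := sh_sub_ne hx (n+1)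
    have h0 := sh_ne n
    have h3 := one_sub_ne hx
    have hs := star hx n
    have e1 : ∀ y, FP y (n+1) = FP y n + W y n / (sh n * (sh n - y)) := fun y => by
      simp [FP, Finset.sum_range_succ]
    have e2 : ∀ y, GP y (n+1) = GP y n + 1 / (4 * sh n ^ 2 * (sh n - y) ^ 2) := fun y => by
      simp [GP, Finset.sum_range_succ]
    rw [e1, e1, e2, e2]
    have hW : W (x-1) (n+1) = (sh n + (x-1)) / (sh n - (x-1)) * W (x-1) n
      + 1 / (sh n * (sh n - (x-1))) := rfl
    rw [hW]
    have hWx : x^2 * (W x n / (sh n * (sh n - x))) =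
       (n / (1 - 2*x) - (sh n + x - 1) * (sh n - x) * W (x-1) n) / (sh n * (sh n - x)) := by
      rw [← hs]; ring
    have goal2 : x^2 * (W x n / (sh n * (sh n - x))) - x^2 * (1 / (4 * sh n ^ 2 * (sh n - x) ^ 2))
      - (x-1)^2 * (W (x-1) n / (sh n * (sh n - (x-1))) - 1 / (4 * sh n ^ 2 * (sh n - (x-1)) ^ 2))
      = (1 / (1-2*x)) * ((n+1:ℕ) * ((sh n + (x-1)) / (sh n - (x-1)) * W (x-1) n
      + 1 / (sh n * (sh n - (x-1)))) - n * W (x-1) n) + 1 / (4 * (sh (n+1) - x)^2)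
        - 1 / (4 * (sh n - x)^2) := by
      rw [hWx]
      rw [sh_succ] at h4 ⊢
      push_cast
      rw [cast_eq]
      have e3 : sh n + 1 - x = sh n - (x-1) := by ring
      rw [e3]
      generalize W (x-1) n = w
      generalize sh n = s at *
      field_simp
      ring
    linear_combination ih + goal2

lemma Fgen_term {x : ℂ} (hre : x.re < 1/2) (hp : ∀ n : ℕ, x + 1/2 ≠ -(n : ℂ)) (n : ℕ) :
    ∑ m ∈ Finset.range n,
    1 / (((n : ℂ) + 1/2) * ((m : ℂ) + 1/2)) *
      (Complex.Gamma (1/2 + (m : ℂ) - x) * Complex.Gamma (1/2 + (n : ℂ) + x)) /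
      (Complex.Gamma (3/2 + (n : ℂ) - x) * Complex.Gamma (3/2 + (m : ℂ) + x))
    = W x n / (sh n * (sh n - x)) := by
  have hs : ∀ n, sh n + x ≠ 0 := fun n h => hp n (by simp only [sh] at h; linear_combination h)
  have g1 : ∀ n, Complex.Gamma (sh n - x) ≠ 0 := fun n => by
    apply Complex.Gamma_ne_zero_of_re_pos
    simp [sh]
    have h2 : (0:ℝ) ≤ n := n.cast_nonneg
    linarith
  have g2 : ∀ n, Complex.Gamma (sh n + x) ≠ 0 := fun n => by
    apply Complex.Gamma_ne_zero
    intro m h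
    apply hp (n+m)
    simp only [sh] at h; push_cast; linear_combination h
  have r1 : ∀ n, Complex.Gamma (sh n + 1 - x) = (sh n - x) * Complex.Gamma (sh n - x) := fun n => by
    rw [← Complex.Gamma_add_one _ (sh_sub_ne hre n)]; congr 1; ring
  have r2 : ∀ n, Complex.Gamma (sh n + 1 + x) = (sh n + x) * Complex.Gamma (sh n + x) := fun n => by
    rw [← Complex.Gamma_add_one _ (hs n)]; congr 1; ring
  have key : ∀ n, W x n = ∑ m ∈ Finset.range n, 1 / sh m * (Complex.Gamma (sh m - x) * Complex.Gamma (sh n + x)) /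
      (Complex.Gamma (sh n - x) * Complex.Gamma (sh m + 1 + x)) := by
    intro n
    induction n with
    | zero => simp [W]
    | succ n ih =>
      rw [Finset.sum_range_succ, W, ih, Finset.mul_sum]
      have a1 := g1 n
      have a2 := g2 n
      have a3 := hs n
      have a4 := sh_sub_ne hre n
      have a5 := sh_ne n
      congr 1
      · apply Finset.sum_congr rfl
        intro m _
        have b1 := g2 m
        have b2 := hs m
        have b3 := sh_ne m
        rw [sh_succ, r1, r2, r2]
        field_simp
      · rw [sh_succ, r1, r2]
        field_simp
  rw [key, Finset.sum_div]
  apply Finset.sum_congr rfl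
  intro m _
  have c1 : (1/2 + (m : ℂ) - x) = sh m - x := by simp only [sh]; ring
  have c2 : (1/2 + (n : ℂ) + x) = sh n + x := by simp only [sh]; ring
  have c3 : (3/2 + (n : ℂ) - x) = sh n + 1 - x := by simp only [sh]; ring
  have c4 : (3/2 + (m : ℂ) + x) = sh m + 1 + x := by simp only [sh]; ring
  rw [c1, c2, c3, c4, r1]
  change 1 / (sh n * sh m) * _ / _ = _
  have a1 := g1 n
  have a2 := g2 m
  have a3 := hs m
  have a4 := sh_sub_ne hre n
  have a5 := sh_ne n
  have a6 := sh_ne m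
  rw [r2]
  field_simp

lemma norm_ratio_le {s σ : ℝ} {x : ℂ} (h0 : 0 ≤ σ) (h1 : σ < s) (hx : x.re ≤ σ) :
    ‖((s:ℂ) + x) / ((s:ℂ) - x)‖ ≤ (s + σ) / (s - σ) := by
  have hne : 0 < ‖(s:ℂ) - x‖ := by
    rw [norm_pos_iff]
    intro h
    have := congrArg Complex.re h
    simp at this
    linarith
  rw [norm_div, div_le_div_iff₀ hne (by linarith)]
  apply le_of_sq_le_sq _ (mul_nonneg (by linarith) (norm_nonneg _))
  rw [mul_pow, mul_pow, Complex.sq_norm, Complex.sq_norm, Complex.normSq_apply, Complex.normSq_apply]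
  simp only [Complex.add_re, Complex.sub_re, Complex.ofReal_re, Complex.add_im, Complex.sub_im,
    Complex.ofReal_im]
  have ha : 0 ≤ s * (σ - x.re) * (s^2 - σ * x.re) := by
    apply mul_nonneg
    · exact mul_nonneg (by linarith) (by linarith)
    · nlinarith
  have hb : 0 ≤ s * σ * x.im^2 := by
    have : 0 ≤ s := by linarith
    positivity
  nlinarith

lemma sh_eq (n : ℕ) : sh n = ((n + 1/2 : ℝ) : ℂ) := by simp [sh]

lemma bern {t p : ℝ} (ht : 0 < t) (hp0 : 0 ≤ p) (hp1 : p < 1) :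
    (t+1)/(t+1-p) ≤ ((t+1)/t)^p := by
  have h := rpow_one_add_le_one_add_mul_self (s := -1/(t+1)) (p := p)
    (by rw [le_div_iff₀ (by linarith)]; linarith) hp0 hp1.le
  have e1 : 1 + -1/(t+1) = ((t+1)/t)⁻¹ := by field_simp; ring
  have e2 : 1 + p * (-1/(t+1)) = ((t+1)/(t+1-p))⁻¹ := by
    have : t + 1 - p ≠ 0 := by linarith
    field_simp
    ring
  rw [e1, e2, Real.inv_rpow (by positivity)] at h
  have hq : 0 < (t+1)/(t+1-p) := by apply div_pos <;> linarith
  exact (inv_le_inv₀ (by positivity) hq).1 h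

lemma W_bound_aux {x : ℂ} {p : ℝ} (hp0 : 0 ≤ p) (hp1 : p < 1) (hx : x.re ≤ p/2) (n : ℕ) :
    ‖W x (n+1)‖ ≤ ((n + 1 + (p-1)/2)/(1+(p-1)/2))^p *
      ∑ m ∈ Finset.range (n+1), ‖1 / (sh m * (sh m - x))‖ := by
  induction n with
  | zero => 
    have : (1 + (p-1)/2) ≠ 0 := by linarith
    simp [W, this]
  | succ n ih =>
    rw [W, Finset.sum_range_succ, mul_add]
    have hn : (0:ℝ) ≤ n := n.cast_nonneg
    set c := (p-1)/2 with hc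
    have hc1 : -1/2 ≤ c := by rw [hc]; linarith
    have hr : ‖(sh (n+1) + x)/(sh (n+1) - x)‖ ≤ ((n+1+c+1)/(n+1+c))^p := by
      rw [sh_eq]
      refine (norm_ratio_le (σ := p/2) (by linarith) (by push_cast; linarith) hx).trans ?_
      refine le_trans (le_of_eq ?_) (bern (t := n+1+c) (by linarith) hp0 hp1)
      push_cast
      rw [hc]
      congr 1 <;> ring
    have hS : 0 ≤ ∑ m ∈ Finset.range (n+1), ‖1 / (sh m * (sh m - x))‖ :=
      Finset.sum_nonneg (fun _ _ => norm_nonneg _)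
    refine (norm_add_le _ _).trans (add_le_add ?_ ?_)
    · rw [norm_mul]
      refine (mul_le_mul hr ih (norm_nonneg _) ?_).trans (le_of_eq ?_)
      · apply Real.rpow_nonneg; apply div_nonneg <;> linarith
      · rw [← mul_assoc, ← Real.mul_rpow (by apply div_nonneg <;> linarith) (by apply div_nonneg <;> linarith)]
        congr 2
        have : n + 1 + c ≠ 0 := by linarith
        have : 1 + c ≠ 0 := by linarith
        push_cast
        field_simp
        ring
    · apply le_mul_of_one_le_left (norm_nonneg _)
      apply Real.one_le_rpow _ hp0
      rw [le_div_iff₀ (by linarith)]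
      push_cast
      linarith

lemma sh_norm (n : ℕ) : ‖sh n‖ = n + 1/2 := by
  rw [sh_eq, Complex.norm_real, Real.norm_eq_abs, abs_of_nonneg (by positivity)]

lemma inv_bound {x : ℂ} (hx : x.re < 1/2) :
    ∃ C : ℝ, 0 ≤ C ∧ ∀ n : ℕ, ‖1 / (sh n * (sh n - x))‖ ≤ C * (1 / ((n:ℝ)+1)^(2:ℝ)) := by
  set d := min 1 (1/2 - x.re) with hd
  have hd0 : 0 < d := lt_min one_pos (by linarith)
  refine ⟨2/d, by positivity, fun n => ?_⟩
  have hn : (0:ℝ) ≤ n := n.cast_nonneg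
  have h1 : ((n:ℝ)+1) * d ≤ ‖sh n - x‖ := by
    refine le_trans ?_ (Complex.re_le_norm _)
    simp [sh]
    have := min_le_left 1 (1/2 - x.re)
    have := min_le_right 1 (1/2 - x.re)
    have := mul_le_mul_of_nonneg_left (min_le_left 1 (1/2 - x.re)) hn
    rw [← hd] at *
    norm_num at *
    linarith
  rw [norm_div, norm_one, norm_mul, sh_norm, div_mul_div_comm, mul_one, Real.rpow_two]
  rw [div_le_div_iff₀ (by apply mul_pos (by positivity); exact lt_of_lt_of_le (by positivity) h1) (by positivity)]
  have h2 := mul_le_mul_of_nonneg_left h1 (by positivity : 0 ≤ 2 * ((n:ℝ)+1/2))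
  have : 0 ≤ (n:ℝ) * ((n+1) * d) := by positivity
  nlinarith

lemma inv_summable {x : ℂ} (hx : x.re < 1/2) :
    Summable (fun n : ℕ => ‖1 / (sh n * (sh n - x))‖) := by
  obtain ⟨C, _, h⟩ := inv_bound hx
  refine Summable.of_nonneg_of_le (fun _ => norm_nonneg _) h (Summable.mul_left _ ?_)
  have := (Real.summable_one_div_nat_add_rpow 1 2).2 (by norm_num)
  refine this.congr (fun n => ?_)
  rw [abs_of_nonneg (by positivity)]

lemma W_bound {x : ℂ} (hx : x.re < 1/2) :
    ∃ C p : ℝ, 0 ≤ C ∧ 0 ≤ p ∧ p < 1 ∧ ∀ n : ℕ, ‖W x n‖ ≤ C * ((n:ℝ)+1)^p := by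
  set p := max 0 (2 * x.re) with hp
  have hp0 : 0 ≤ p := le_max_left _ _
  have hp1 : p < 1 := max_lt one_pos (by linarith)
  have hxp : x.re ≤ p/2 := by have := le_max_right 0 (2 * x.re); rw [← hp] at this; linarith
  set S := ∑' n : ℕ, ‖1 / (sh n * (sh n - x))‖ with hS
  have hS0 : 0 ≤ S := tsum_nonneg (fun _ => norm_nonneg _)
  refine ⟨(2:ℝ)^p * S, p, by positivity, hp0, hp1, fun n => ?_⟩
  rcases n with _ | n
  · simp [W]; positivity
  · have hn : (0:ℝ) ≤ n := n.cast_nonneg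
    refine (W_bound_aux hp0 hp1 hxp n).trans ?_
    have h1 : ∑ m ∈ Finset.range (n+1), ‖1 / (sh m * (sh m - x))‖ ≤ S :=
      (inv_summable hx).sum_le_tsum _ (fun _ _ => norm_nonneg _)
    have h2 : ((n + 1 + (p-1)/2)/(1+(p-1)/2))^p ≤ (2 * ((n+1:ℕ)+1))^p := by
      apply Real.rpow_le_rpow _ _ hp0
      · apply div_nonneg <;> linarith
      · rw [div_le_iff₀ (by linarith)]
        push_cast
        nlinarith
    refine (mul_le_mul h2 h1 (Finset.sum_nonneg (fun _ _ => norm_nonneg _)) (by positivity)).trans ?_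
    rw [Real.mul_rpow (by positivity) (by positivity)]
    apply le_of_eq; ring

lemma F_summable {x : ℂ} (hx : x.re < 1/2) :
    Summable (fun n : ℕ => W x n / (sh n * (sh n - x))) := by
  obtain ⟨C, hC, h⟩ := inv_bound hx
  obtain ⟨D, p, hD, hp0, hp1, h'⟩ := W_bound hx
  have := (Real.summable_one_div_nat_add_rpow 1 (2-p)).2 (by linarith)
  refine Summable.of_norm_bounded (this.mul_left (D * C)) (fun n => ?_)
  rw [div_eq_mul_one_div, norm_mul]
  refine (mul_le_mul (h' n) (h n) (norm_nonneg _) (by positivity)).trans (le_of_eq ?_)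
  rw [abs_of_nonneg (by positivity), Real.rpow_sub (by positivity)]
  field_simp

lemma W_div_tendsto {x : ℂ} (hx : x.re < 1/2) :
    Filter.Tendsto (fun n : ℕ => W x n / n) Filter.atTop (nhds 0) := by
  obtain ⟨D, p, hD, hp0, hp1, h'⟩ := W_bound hx
  have h1 : Filter.Tendsto (fun n : ℕ => 2 * D * ((n:ℝ)+1)^(-(1-p))) Filter.atTop (nhds (2 * D * 0)) := by
    apply Filter.Tendsto.const_mul
    exact (tendsto_rpow_neg_atTop (by linarith)).comp
      (Filter.tendsto_atTop_add_const_right _ _ tendsto_natCast_atTop_atTop)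
  rw [mul_zero] at h1
  refine squeeze_zero_norm' ?_ h1
  filter_upwards [Filter.eventually_ge_atTop 1] with n hn
  have hn' : (1:ℝ) ≤ n := by exact_mod_cast hn
  rw [norm_div, Complex.norm_natCast, div_le_iff₀ (by linarith)]
  refine (h' n).trans ?_
  have e : ((n:ℝ)+1)^p = ((n:ℝ)+1)^(-(1-p)) * (n+1) := by
    nth_rewrite 3 [← Real.rpow_one ((n:ℝ)+1)]
    rw [← Real.rpow_add (by positivity)]
    congr 1; ring
  rw [e]
  have : 0 ≤ D * ((n:ℝ)+1)^(-(1-p)) := by positivity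
  nlinarith

lemma inv_nat_tendsto (a : ℂ) : Filter.Tendsto (fun n : ℕ => a / (n:ℂ)) Filter.atTop (nhds 0) :=
  tendsto_const_div_atTop_nhds_zero_nat a

lemma NW_tendsto {x : ℂ} (hx : x.re < 1/2) :
    Filter.Tendsto (fun n : ℕ => n * W (x-1) n) Filter.atTop (nhds (1/(1-2*x))) := by
  have h1 : Filter.Tendsto (fun n : ℕ => (1 + (x - 1/2)/(n:ℂ)) * (1 + (1/2 - x)/(n:ℂ)))
      Filter.atTop (nhds 1) := by
    have := ((inv_nat_tendsto (x-1/2)).const_add 1).mul ((inv_nat_tendsto (1/2-x)).const_add 1)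
    simpa using this
  have h2 : Filter.Tendsto (fun n : ℕ => 1/(1-2*x) - x^2 * (W x n / n))
      Filter.atTop (nhds (1/(1-2*x))) := by
    have := ((W_div_tendsto hx).const_mul (x^2)).const_sub (1/(1-2*x))
    simpa using this
  have h3 := h2.div h1 one_ne_zero
  rw [div_one] at h3
  refine h3.congr' ?_
  filter_upwards [h1.eventually_ne one_ne_zero, Filter.eventually_ge_atTop 1] with n hn hn1
  have hn' : (n:ℂ) ≠ 0 := by exact_mod_cast (by omega : n ≠ 0)
  simp only [Pi.div_apply]
  rw [div_eq_iff hn]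
  have hs := star hx n
  have e : 1/(1-2*x) = (x^2 * W x n + (sh n + x - 1) * (sh n - x) * W (x-1) n) / n := by
    rw [hs]; field_simp
  rw [e]
  simp only [sh]
  field_simp
  ring

noncomputable def Fs (x : ℂ) : ℂ := ∑' n : ℕ, W x n / (sh n * (sh n - x))
noncomputable def Gs (x : ℂ) : ℂ := ∑' n : ℕ, 1 / (4 * sh n ^ 2 * (sh n - x) ^ 2)
noncomputable def K (x : ℂ) : ℂ := x^2 * (Fs x - Gs x)

lemma G_summable {x : ℂ} (hx : x.re < 1/2) :
    Summable (fun n : ℕ => 1 / (4 * sh n ^ 2 * (sh n - x) ^ 2)) := by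
  obtain ⟨C, hC, h⟩ := inv_bound hx
  refine Summable.of_norm_bounded ((inv_summable hx).mul_left C) (fun n => ?_)
  have e : 1 / (4 * sh n ^ 2 * (sh n - x) ^ 2) = 1/4 * ((1 / (sh n * (sh n - x))) * (1 / (sh n * (sh n - x)))) := by
    have := sh_ne n
    have := sh_sub_ne hx n
    field_simp
  rw [e, norm_mul, norm_mul]
  have h1 : ‖1 / (sh n * (sh n - x))‖ ≤ C := by
    refine (h n).trans (mul_le_of_le_one_right hC ?_)
    rw [div_le_one (by positivity)]
    apply Real.one_le_rpow _ (by norm_num)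
    have hn : (0:ℝ) ≤ n := n.cast_nonneg
    linarith
  have h2 := mul_le_mul_of_nonneg_right h1 (norm_nonneg (1 / (sh n * (sh n - x))))
  have h3 : ‖(1/4:ℂ)‖ ≤ 1 := by norm_num
  refine (mul_le_of_le_one_left (by positivity) h3).trans h2

lemma K_per {x : ℂ} (hx : x.re < 1/2) : K x = K (x-1) := by
  have hy : (x-1).re < 1/2 := by simp; linarith
  have h1 : Filter.Tendsto (fun N : ℕ => x^2 * (FP x N - GP x N) - (x-1)^2 * (FP (x-1) N - GP (x-1) N))
      Filter.atTop (nhds (K x - K (x-1))) := by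
    have a1 := (F_summable hx).hasSum.tendsto_sum_nat
    have a2 := (F_summable hy).hasSum.tendsto_sum_nat
    have a3 := (G_summable hx).hasSum.tendsto_sum_nat
    have a4 := (G_summable hy).hasSum.tendsto_sum_nat
    exact ((a1.sub a3).const_mul (x^2)).sub ((a2.sub a4).const_mul ((x-1)^2))
  have h2 : Filter.Tendsto (fun N : ℕ => (1 / (1-2*x)) * (N * W (x-1) N - 1/(1-2*x)) + 1 / (4 * (sh N - x)^2))
      Filter.atTop (nhds ((1 / (1-2*x)) * (1/(1-2*x) - 1/(1-2*x)) + 0)) := by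
    apply Filter.Tendsto.add
    · exact ((NW_tendsto hx).sub_const _).const_mul _
    · have := (G_summable hx)
      have t : Filter.Tendsto (fun N : ℕ => ‖sh N - x‖) Filter.atTop Filter.atTop := by
        refine Filter.tendsto_atTop_mono (f := fun N : ℕ => (N:ℝ) + (1/2 - x.re)) (fun N => ?_) 
          (Filter.tendsto_atTop_add_const_right _ _ tendsto_natCast_atTop_atTop)
        refine le_trans (le_of_eq ?_) (Complex.re_le_norm _)
        simp [sh]; ring
      rw [tendsto_zero_iff_norm_tendsto_zero]
      have t2 : Filter.Tendsto (fun N : ℕ => 4 * ‖sh N - x‖^2) Filter.atTop Filter.atTop :=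
        ((Filter.tendsto_pow_atTop (by norm_num)).comp t).const_mul_atTop (by norm_num)
      have := t2.inv_tendsto_atTop
      refine this.congr (fun N => ?_)
      simp
  have h3 := tendsto_nhds_unique (h1.congr (fun N => fin_rec hx N)) h2
  rw [sub_self, mul_zero, add_zero] at h3
  exact sub_eq_zero.1 h3

lemma W_bound_neg {x : ℂ} (hx : x.re ≤ 0) (n : ℕ) :
    ‖W x n‖ ≤ ∑ m ∈ Finset.range n, ‖1 / (sh m * (sh m - x))‖ := by
  induction n with
  | zero => simp [W]
  | succ n ih =>
    rw [W, Finset.sum_range_succ]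
    refine (norm_add_le _ _).trans (add_le_add ?_ le_rfl)
    rw [norm_mul]
    refine (mul_le_of_le_one_left (norm_nonneg _) ?_).trans ih
    rw [sh_eq]
    refine (norm_ratio_le (σ := 0) le_rfl (by positivity) hx).trans (le_of_eq ?_)
    rw [add_zero, sub_zero, div_self (by positivity)]

lemma le_norm_sub {x : ℂ} (hx : x.re ≤ 0) (n : ℕ) : (n:ℝ) + 1/2 ≤ ‖sh n - x‖ := by
  refine le_trans ?_ (Complex.re_le_norm _)
  simp [sh]; linarith

lemma norm_le_norm_sub {x : ℂ} (hx : x.re ≤ 0) (n : ℕ) : ‖x‖ ≤ ‖sh n - x‖ := by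
  apply le_of_sq_le_sq _ (norm_nonneg _)
  rw [Complex.sq_norm, Complex.sq_norm, Complex.normSq_apply, Complex.normSq_apply]
  simp [sh]
  have hn : (0:ℝ) ≤ n := n.cast_nonneg
  nlinarith [mul_nonneg hn (neg_nonneg.2 hx)]

noncomputable def u2 (n : ℕ) : ℝ := 1 / ((n:ℝ) + 1/2)^(2:ℝ)
noncomputable def u43 (n : ℕ) : ℝ := 1 / ((n:ℝ) + 1/2)^(4/3:ℝ)

lemma u2_summable : Summable u2 := by
  have := (Real.summable_one_div_nat_add_rpow (1/2) 2).2 (by norm_num)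
  refine this.congr (fun n => ?_)
  rw [abs_of_nonneg (by positivity), u2]

lemma u43_summable : Summable u43 := by
  have := (Real.summable_one_div_nat_add_rpow (1/2) (4/3)).2 (by norm_num)
  refine this.congr (fun n => ?_)
  rw [abs_of_nonneg (by positivity), u43]

lemma u2_nonneg (n : ℕ) : 0 ≤ u2 n := by unfold u2; positivity
lemma u43_nonneg (n : ℕ) : 0 ≤ u43 n := by unfold u43; positivity

lemma inv_le_u2 {x : ℂ} (hx : x.re ≤ 0) (n : ℕ) : ‖1 / (sh n * (sh n - x))‖ ≤ u2 n := by
  rw [u2, norm_div, norm_one, norm_mul, sh_norm, Real.rpow_two, sq]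
  have := le_norm_sub hx n
  gcongr

lemma inv_le_u43 {x : ℂ} (hx : x.re ≤ 0) (hx0 : x ≠ 0) (n : ℕ) :
    ‖1 / (sh n * (sh n - x))‖ ≤ u43 n * ‖x‖^(-(2/3) : ℝ) := by
  have hx1 : 0 < ‖x‖ := norm_pos_iff.2 hx0
  have hs : 0 < (n:ℝ) + 1/2 := by positivity
  have hd : 0 < ‖sh n - x‖ := lt_of_lt_of_le hs (le_norm_sub hx n)
  rw [u43, norm_div, norm_one, norm_mul, sh_norm, Real.rpow_neg hx1.le, ← div_eq_mul_inv, div_div]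
  have h1 : ((n:ℝ)+1/2)^(1/3:ℝ) * ‖x‖^(2/3:ℝ) ≤ ‖sh n - x‖ := by
    calc _ ≤ ‖sh n - x‖^(1/3:ℝ) * ‖sh n - x‖^(2/3:ℝ) := by
          have := le_norm_sub hx n
          have := norm_le_norm_sub hx n
          gcongr
      _ = ‖sh n - x‖ := by
          rw [← Real.rpow_add hd]; norm_num
  have h2 : ((n:ℝ)+1/2)^(4/3:ℝ) = ((n:ℝ)+1/2) * ((n:ℝ)+1/2)^(1/3:ℝ) := by
    nth_rewrite 2 [← Real.rpow_one ((n:ℝ)+1/2)]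
    rw [← Real.rpow_add hs]; norm_num
  rw [h2, mul_assoc]
  gcongr

lemma F_term_u2 {x : ℂ} (hx : x.re ≤ 0) (n : ℕ) :
    ‖W x n / (sh n * (sh n - x))‖ ≤ (∑' m, u2 m) * u2 n := by
  rw [div_eq_mul_one_div, norm_mul]
  apply mul_le_mul _ (inv_le_u2 hx n) (norm_nonneg _) (tsum_nonneg u2_nonneg)
  refine (W_bound_neg hx n).trans ((Finset.sum_le_sum (fun m _ => inv_le_u2 hx m)).trans ?_)
  exact u2_summable.sum_le_tsum _ (fun m _ => u2_nonneg m)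

lemma F_term_u43 {x : ℂ} (hx : x.re ≤ 0) (hx0 : x ≠ 0) (n : ℕ) :
    ‖W x n / (sh n * (sh n - x))‖ ≤ ((∑' m, u43 m) * ‖x‖^(-(2/3) : ℝ)) * (u43 n * ‖x‖^(-(2/3) : ℝ)) := by
  rw [div_eq_mul_one_div, norm_mul]
  apply mul_le_mul _ (inv_le_u43 hx hx0 n) (norm_nonneg _)
    (mul_nonneg (tsum_nonneg u43_nonneg) (by positivity))
  refine (W_bound_neg hx n).trans ((Finset.sum_le_sum (fun m _ => inv_le_u43 hx hx0 m)).trans ?_)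
  rw [← Finset.sum_mul]
  gcongr
  exact u43_summable.sum_le_tsum _ (fun m _ => u43_nonneg m)

lemma W_diff (n : ℕ) : DifferentiableOn ℂ (fun x => W x n) {x | x.re < 0} := by
  induction n with
  | zero => simp only [W]; exact differentiableOn_const _
  | succ n ih =>
    simp only [W]
    have h : ∀ x ∈ {x : ℂ | x.re < 0}, sh n - x ≠ 0 := fun x hx => sh_sub_ne (by 
      have : x.re < 0 := hx
      linarith) n
    have h' : ∀ x ∈ {x : ℂ | x.re < 0}, sh n * (sh n - x) ≠ 0 := fun x hx =>
      mul_ne_zero (sh_ne n) (h x hx)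
    have d1 : DifferentiableOn ℂ (fun x : ℂ => sh n - x) {x | x.re < 0} := by fun_prop
    have d2 : DifferentiableOn ℂ (fun x : ℂ => sh n + x) {x | x.re < 0} := by fun_prop
    have d3 : DifferentiableOn ℂ (fun x : ℂ => sh n * (sh n - x)) {x | x.re < 0} := by fun_prop
    exact ((d2.div d1 h).mul ih).add ((differentiableOn_const 1).div d3 h')

lemma open_neg : IsOpen {x : ℂ | x.re < 0} := isOpen_lt Complex.continuous_re continuous_const

lemma G_term_le {x : ℂ} (hx : x.re ≤ 0) (n : ℕ) :
    ‖1 / (4 * sh n ^ 2 * (sh n - x) ^ 2)‖ ≤ u2 n := by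
  rw [u2, norm_div, norm_one, norm_mul, norm_mul, norm_pow, norm_pow, sh_norm, Real.rpow_two]
  have h := le_norm_sub hx n
  have hn : (0:ℝ) ≤ n := n.cast_nonneg
  apply one_div_le_one_div_of_le (by positivity)
  have : (1:ℝ)/4 ≤ ‖sh n - x‖^2 := by nlinarith
  norm_num
  nlinarith [sq_nonneg ((n:ℝ) + 1/2)]

lemma G_term_le' {x : ℂ} (hx : x.re ≤ 0) (n : ℕ) :
    ‖x^2 * (1 / (4 * sh n ^ 2 * (sh n - x) ^ 2))‖ ≤ u2 n := by
  rw [u2, norm_mul, norm_div, norm_one, norm_mul, norm_mul, norm_pow, norm_pow, norm_pow, sh_norm, Real.rpow_two]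
  have h := norm_le_norm_sub hx n
  have hs : 0 < (n:ℝ) + 1/2 := by positivity
  have hd : 0 < ‖sh n - x‖ := lt_of_lt_of_le hs (le_norm_sub hx n)
  have : ‖x‖^2 ≤ ‖sh n - x‖^2 := by gcongr
  have e4 : ‖(4:ℂ)‖ = 4 := by norm_num
  rw [e4, mul_one_div, div_le_div_iff₀ (by positivity) (by positivity)]
  have h2 := mul_le_mul_of_nonneg_right this (sq_nonneg ((n:ℝ)+1/2))
  have h3 : 0 ≤ ((n:ℝ)+1/2)^2 * ‖sh n - x‖^2 := by positivity
  linarith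

lemma K_diff : DifferentiableOn ℂ K {x | x.re < 0} := by
  have hF : DifferentiableOn ℂ Fs {x | x.re < 0} := by
    apply Complex.differentiableOn_tsum_of_summable_norm (u2_summable.mul_left (∑' m, u2 m)) _ open_neg
    · intro n x hx
      exact F_term_u2 (le_of_lt hx) n
    · intro n
      apply (W_diff n).div (by fun_prop)
      intro x hx
      have : x.re < 0 := hx
      exact mul_ne_zero (sh_ne n) (sh_sub_ne (by linarith) n)
  have hG : DifferentiableOn ℂ Gs {x | x.re < 0} := by
    apply Complex.differentiableOn_tsum_of_summable_norm u2_summable _ open_neg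
    · intro n x hx
      exact G_term_le (le_of_lt hx) n
    · intro n
      apply (differentiableOn_const _).div (by fun_prop)
      intro x hx
      have : x.re < 0 := hx
      have h1 := sh_ne n
      have h2 := sh_sub_ne (x := x) (by linarith) n
      exact mul_ne_zero (mul_ne_zero (by norm_num) (pow_ne_zero 2 h1)) (pow_ne_zero 2 h2)
  exact (differentiableOn_id.pow 2).mul (hF.sub hG)

lemma K_growth : ∃ A B : ℝ, 0 ≤ A ∧ 0 ≤ B ∧ ∀ x : ℂ, x.re ≤ 0 → ‖K x‖ ≤ A * ‖x‖^(2/3:ℝ) + B := by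
  refine ⟨(∑' m, u43 m) * (∑' m, u43 m), ∑' m, u2 m, mul_self_nonneg _, tsum_nonneg u2_nonneg, fun x hx => ?_⟩
  by_cases hx0 : x = 0
  · simp [hx0, K]
    exact tsum_nonneg u2_nonneg
  have hx1 : 0 < ‖x‖ := norm_pos_iff.2 hx0
  rw [K, mul_sub]
  refine (norm_sub_le _ _).trans (add_le_add ?_ ?_)
  · have : ‖Fs x‖ ≤ ((∑' m, u43 m) * ‖x‖^(-(2/3) : ℝ)) * ((∑' m, u43 m) * ‖x‖^(-(2/3) : ℝ)) := by
      apply tsum_of_norm_bounded _ (F_term_u43 hx hx0)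
      exact (u43_summable.hasSum.mul_right _).mul_left _
    rw [norm_mul, norm_pow]
    refine (mul_le_mul_of_nonneg_left this (by positivity)).trans (le_of_eq ?_)
    have e : ‖x‖^(2/3:ℝ) = ‖x‖^2 * (‖x‖^(-(2/3) : ℝ) * ‖x‖^(-(2/3) : ℝ)) := by
      rw [← Real.rpow_two, ← Real.rpow_add hx1, ← Real.rpow_add hx1]; norm_num
    rw [e]; ring
  · rw [Gs, ← tsum_mul_left]
    exact tsum_of_norm_bounded u2_summable.hasSum (G_term_le' hx)

lemma K_per_nat {x : ℂ} (hx : x.re < 1/2) (k : ℕ) : K x = K (x - k) := by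
  induction k with
  | zero => simp
  | succ k ih =>
    rw [ih, K_per (by simp; have : (0:ℝ) ≤ k := k.cast_nonneg
                      linarith)]
    congr 1; push_cast; ring

lemma K_deriv {x : ℂ} (hx : x.re < 0) : deriv K x = 0 := by
  obtain ⟨A, B, hA, hB, hK⟩ := K_growth
  have h1 : ∀ k : ℕ, deriv K x = deriv K (x - k) := by
    intro k
    rw [← deriv_comp_sub_const]
    apply Filter.EventuallyEq.deriv_eq
    filter_upwards [open_neg.mem_nhds hx] with y hy
    exact K_per_nat (by have : y.re < 0 := hy
                        linarith) k
  have h2 : ∀ᶠ k : ℕ in Filter.atTop, ‖deriv K x‖ ≤ A * 3^(2/3:ℝ) * (k:ℝ)^(-(1/3):ℝ) + B / k := by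
    filter_upwards [Filter.eventually_ge_atTop 1, Filter.eventually_ge_atTop (Nat.ceil ‖x‖)] with k hk1 hk2
    have hk : (0:ℝ) < k := by exact_mod_cast hk1
    have hkx : ‖x‖ ≤ k := (Nat.le_ceil _).trans (by exact_mod_cast hk2)
    rw [h1 k]
    have hsub : Metric.closedBall (x - k) k ⊆ {z : ℂ | z.re < 0} := by
      intro z hz
      rw [Metric.mem_closedBall, dist_eq_norm] at hz
      have := (Complex.re_le_norm _).trans hz
      simp at this
      simp
      linarith
    have := Complex.norm_deriv_le_of_forall_mem_sphere_norm_le (f := K) (c := x - k) (R := k)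
      (C := A * (3*k)^(2/3:ℝ) + B) hk ?_ ?_
    · refine this.trans (le_of_eq ?_)
      rw [add_div, Real.mul_rpow (by norm_num) hk.le]
      have e : (k:ℝ)^(2/3:ℝ) = (k:ℝ)^(-(1/3):ℝ) * k := by
        nth_rewrite 3 [← Real.rpow_one (k:ℝ)]
        rw [← Real.rpow_add hk]; norm_num
      rw [e]
      field_simp
    · apply DifferentiableOn.diffContOnCl
      exact K_diff.mono (Metric.closure_ball_subset_closedBall.trans hsub)
    · intro z hz
      have hz2 : z.re < 0 := hsub (Metric.sphere_subset_closedBall hz)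
      refine (hK z hz2.le).trans ?_
      have : ‖z‖ ≤ 3 * k := by
        rw [mem_sphere_iff_norm] at hz
        have e : z = (z - (x - k)) + x - k := by ring
        rw [e]
        refine (norm_sub_le _ _).trans ?_
        refine (add_le_add_left (norm_add_le _ _) _).trans ?_
        rw [hz, Complex.norm_natCast]
        linarith
      gcongr
  have h3 : Filter.Tendsto (fun k : ℕ => A * 3^(2/3:ℝ) * (k:ℝ)^(-(1/3):ℝ) + B / k) Filter.atTop (nhds (A * 3^(2/3:ℝ) * 0 + 0)) := by
    apply Filter.Tendsto.add
    · apply Filter.Tendsto.const_mul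
      exact (tendsto_rpow_neg_atTop (by norm_num)).comp tendsto_natCast_atTop_atTop
    · exact tendsto_const_div_atTop_nhds_zero_nat B
  rw [mul_zero, add_zero] at h3
  have := ge_of_tendsto h3 h2
  exact norm_le_zero_iff.1 this

lemma K_zero {x : ℂ} (hx : x.re < 1/2) : K x = 0 := by
  have hc : ∀ x y : ℂ, x.re < 0 → y.re < 0 → K x = K y := by
    intro x y hx hy
    apply open_neg.is_const_of_deriv_eq_zero (convex_halfSpace_re_lt 0).isPreconnected K_diff
      (fun z hz => K_deriv hz) hx hy
  have h0 : K 0 = 0 := by simp [K]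
  rw [K_per hx, hc (x-1) (0-1) (by simp; linarith) (by simp), ← K_per (by simp), h0]

lemma Fs_eq_Gs {x : ℂ} (hx : x.re < 1/2) (hx0 : x ≠ 0) : Fs x = Gs x := by
  have := K_zero hx
  rw [K] at this
  rcases mul_eq_zero.1 this with h | h
  · exact absurd h (pow_ne_zero 2 hx0)
  · exact sub_eq_zero.1 h

noncomputable def DR (t : ℝ) : ℝ := deriv (Real.log ∘ Real.Gamma) t

lemma ne_neg_nat {z : ℂ} (hz : 0 < z.re) (m : ℕ) : z ≠ -(m:ℂ) := by
  intro h
  rw [h] at hz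
  simp at hz
  have : (0:ℝ) ≤ m := m.cast_nonneg
  linarith

lemma gamma_real_diff {t : ℝ} (ht : 0 < t) : DifferentiableAt ℝ Real.Gamma t := by
  apply Real.differentiableAt_Gamma
  intro m h
  rw [h] at ht
  have : (0:ℝ) ≤ m := m.cast_nonneg
  linarith

lemma DR_eq {t : ℝ} (ht : 0 < t) : DR t = deriv Real.Gamma t / Real.Gamma t := by
  have h := (gamma_real_diff ht).hasDerivAt.log (Real.Gamma_pos_of_pos ht).ne'
  exact h.deriv

lemma digamma_ofReal {t : ℝ} (ht : 0 < t) : Complex.digamma t = (DR t : ℂ) := by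
  rw [DR_eq ht, Complex.digamma_def, logDeriv_apply, Complex.Gamma_ofReal, Complex.ofReal_div]
  congr 1
  have h1 : HasDerivAt (fun y : ℝ => Complex.Gamma y) (deriv Complex.Gamma t) t := by
    apply HasDerivAt.comp_ofReal
    exact (Complex.differentiableAt_Gamma _ (ne_neg_nat (by simpa using ht))).hasDerivAt
  have h2 : HasDerivAt (fun y : ℝ => ((Real.Gamma y : ℝ) : ℂ)) ((deriv Real.Gamma t : ℝ) : ℂ) t :=
    (gamma_real_diff ht).hasDerivAt.ofReal_comp
  simp only [Complex.Gamma_ofReal] at h1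
  exact h1.unique h2

lemma DR_succ {t : ℝ} (ht : 0 < t) : DR (t+1) = DR t + 1/t := by
  have h := Complex.digamma_apply_add_one (t:ℂ) (ne_neg_nat (by simpa using ht))
  have e : (t:ℂ) + 1 = ((t+1:ℝ):ℂ) := by push_cast; rfl
  rw [e, digamma_ofReal ht, digamma_ofReal (by linarith)] at h
  rw [one_div]
  exact_mod_cast h

lemma DR_add_nat {t : ℝ} (ht : 0 < t) (N : ℕ) :
    DR (t+N) = DR t + ∑ n ∈ Finset.range N, 1/((n:ℝ)+t) := by
  induction N with
  | zero => simp
  | succ N ih =>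
    rw [Finset.sum_range_succ, ← add_assoc, ← ih]
    have := DR_succ (t := t + N) (by positivity)
    push_cast
    rw [← add_assoc, this]
    congr 2; ring

lemma DR_mono : MonotoneOn DR (Set.Ioi 0) := by
  apply Real.convexOn_log_Gamma.monotoneOn_deriv
  intro t ht
  have ht' : 0 < t := ht
  exact (gamma_real_diff ht').log (Real.Gamma_pos_of_pos ht').ne'

lemma DR_tendsto {t : ℝ} (h1 : 1/2 ≤ t) (h2 : t ≤ 3/2) :
    Filter.Tendsto (fun N : ℕ => ∑ n ∈ Finset.range N, (1/((n:ℝ)+1/2) - 1/((n:ℝ)+t))) Filter.atTop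
      (nhds (DR t - DR (1/2))) := by
  have e : ∀ N : ℕ, ∑ n ∈ Finset.range N, (1/((n:ℝ)+1/2) - 1/((n:ℝ)+t))
     = DR t - DR (1/2) - (DR (t+N) - DR (1/2+N)) := by
    intro N
    rw [DR_add_nat (by linarith), DR_add_nat (by norm_num), Finset.sum_sub_distrib]
    ring
  have l : Filter.Tendsto (fun N : ℕ => DR (t+N) - DR (1/2+N)) Filter.atTop (nhds 0) := by
    refine squeeze_zero' (g := fun N : ℕ => 1 / (N:ℝ)) ?_ ?_ (tendsto_const_div_atTop_nhds_zero_nat 1)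
    · filter_upwards with N
      have hN : (0:ℝ) ≤ N := N.cast_nonneg
      apply sub_nonneg.2
      exact DR_mono (by simp; positivity) (by simp; linarith) (by linarith)
    · filter_upwards [Filter.eventually_ge_atTop 1] with N hN
      have hN : (1:ℝ) ≤ N := by exact_mod_cast hN
      have a := DR_mono (a := t + N) (b := 1/2 + N + 1) (by simp; linarith) (by simp; linarith) (by linarith)
      rw [DR_succ (by linarith)] at a
      have b : 1/(1/2 + (N:ℝ)) ≤ 1/N := by apply one_div_le_one_div_of_le <;> linarith
      linarith
  have := l.const_sub (DR t - DR (1/2))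
  rw [sub_zero] at this
  exact this.congr (fun N => (e N).symm)

/-- region -/
def reg (δ R : ℝ) : Set ℂ := {z | δ < z.re} ∩ Metric.ball 0 R

lemma reg_open (δ R : ℝ) : IsOpen (reg δ R) :=
  (isOpen_lt continuous_const Complex.continuous_re).inter Metric.isOpen_ball

lemma reg_conn (δ R : ℝ) : IsPreconnected (reg δ R) :=
  ((convex_halfSpace_re_gt δ).inter (convex_ball 0 R)).isPreconnected

lemma reg_ne {δ R : ℝ} (hδ : 0 < δ) {z : ℂ} (hz : z ∈ reg δ R) (n : ℕ) : (n:ℂ) + z ≠ 0 := by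
  intro h
  exact ne_neg_nat (hδ.trans hz.1) n (by linear_combination h)

lemma term_bound {δ R : ℝ} (hδ : 0 < δ) (hδ1 : δ ≤ 1/2) {z : ℂ} (hz : z ∈ reg δ R) (n : ℕ) :
    ‖1 / sh n - 1/((n:ℂ)+z)‖ ≤ (R+1) / δ * u2 n := by
  have hn : (0:ℝ) ≤ n := n.cast_nonneg
  have h1 : ((n:ℝ)+1/2) * δ ≤ ‖(n:ℂ)+z‖ := by
    refine le_trans ?_ (Complex.re_le_norm _)
    simp only [Complex.add_re, Complex.natCast_re]
    have : δ < z.re := hz.1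
    nlinarith
  have hz2 : ‖z‖ < R := by have := hz.2; simpa using this
  have e : 1 / sh n - 1/((n:ℂ)+z) = (z - 1/2) / (sh n * (n+z)) := by
    have := sh_ne n
    have := reg_ne hδ hz n
    field_simp
    simp only [sh]; ring
  rw [e, norm_div, norm_mul, sh_norm, u2, Real.rpow_two, div_mul_div_comm]
  have h3 : ‖z - 1/2‖ ≤ (R+1) * 1 := by
    refine (norm_sub_le _ _).trans ?_
    norm_num
    linarith
  have : 0 ≤ R := (norm_nonneg z).trans hz2.le
  apply div_le_div₀ (by positivity) h3 (by positivity)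
  calc _ = ((n:ℝ)+1/2) * (((n:ℝ)+1/2) * δ) := by ring
    _ ≤ _ := by gcongr

lemma term_diff {δ R : ℝ} (hδ : 0 < δ) (n : ℕ) :
    DifferentiableOn ℂ (fun z : ℂ => 1 / sh n - 1/((n:ℂ)+z)) (reg δ R) := by
  apply (differentiableOn_const _).sub
  apply (differentiableOn_const _).div (by fun_prop)
  intro z hz
  exact reg_ne hδ hz n

lemma digamma_diff {z : ℂ} (h : ∀ m : ℕ, z ≠ -(m:ℂ)) : DifferentiableAt ℂ Complex.digamma z := by
  have ho : IsOpen {z : ℂ | Complex.Gamma⁻¹ z ≠ 0} := by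
    have : Continuous (Complex.Gamma⁻¹) := by
      have := Complex.differentiable_one_div_Gamma.continuous
      exact this
    exact isOpen_ne_fun this continuous_const
  have hs : ∀ w : ℂ, Complex.Gamma⁻¹ w ≠ 0 → ∀ m : ℕ, w ≠ -(m:ℂ) := by
    intro w hw m hm
    apply hw
    simp [hm, Complex.Gamma_neg_nat_eq_zero]
  have hd : DifferentiableOn ℂ Complex.Gamma {z : ℂ | Complex.Gamma⁻¹ z ≠ 0} := fun w hw =>
    (Complex.differentiableAt_Gamma w (hs w hw)).differentiableWithinAt
  have hm : z ∈ {z : ℂ | Complex.Gamma⁻¹ z ≠ 0} := by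
    simp [Complex.Gamma_ne_zero h]
  rw [Complex.digamma_def]
  have := (hd.deriv ho).differentiableAt (ho.mem_nhds hm)
  exact this.div (Complex.differentiableAt_Gamma z h) (Complex.Gamma_ne_zero h)

lemma digamma_eqOn {δ R : ℝ} (hδ : 0 < δ) (hδ1 : δ ≤ 1/2) (hR : 2 ≤ R) :
    Set.EqOn (fun z => Complex.digamma z - Complex.digamma (1/2))
      (fun z => ∑' n : ℕ, (1 / sh n - 1/((n:ℂ)+z))) (reg δ R) := by
  have hS : DifferentiableOn ℂ (fun z => ∑' n : ℕ, (1 / sh n - 1/((n:ℂ)+z))) (reg δ R) :=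
    Complex.differentiableOn_tsum_of_summable_norm (u2_summable.mul_left ((R+1)/δ)) (term_diff hδ)
      (reg_open δ R) (fun n w hw => term_bound hδ hδ1 hw n)
  have hD : DifferentiableOn ℂ (fun z => Complex.digamma z - Complex.digamma (1/2)) (reg δ R) := by
    intro z hz
    exact ((digamma_diff (ne_neg_nat (hδ.trans hz.1))).sub_const _).differentiableWithinAt
  have h1 : (1:ℂ) ∈ reg δ R := by
    constructor
    · simp; linarith
    · simp; linarith
  have key : ∀ t : ℝ, 1/2 < t → t < 3/2 → Complex.digamma t - Complex.digamma (1/2) =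
      ∑' n : ℕ, (1 / sh n - 1/((n:ℂ)+t)) := by
    intro t ht1 ht2
    have hm : (t:ℂ) ∈ reg δ R := by
      constructor
      · simp; linarith
      · simp; rw [abs_of_nonneg] <;> linarith
    have hs : Summable (fun n : ℕ => 1 / sh n - 1/((n:ℂ)+t)) :=
      Summable.of_norm_bounded (u2_summable.mul_left ((R+1)/δ)) (fun n => term_bound hδ hδ1 hm n)
    have a := hs.hasSum.tendsto_sum_nat
    have b := (Complex.continuous_ofReal.tendsto _).comp (DR_tendsto ht1.le ht2.le)
    have e : Complex.digamma (1/2) = (DR (1/2) : ℂ) := by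
      rw [← digamma_ofReal (by norm_num)]; norm_num
    rw [e, digamma_ofReal (by linarith), ← Complex.ofReal_sub]
    refine tendsto_nhds_unique b (a.congr (fun N => ?_))
    simp [sh]
  apply AnalyticOnNhd.eqOn_of_preconnected_of_frequently_eq (hD.analyticOnNhd (reg_open δ R))
    (hS.analyticOnNhd (reg_open δ R)) (reg_conn δ R) h1
  have hfr : ∃ᶠ t : ℝ in nhdsWithin 1 {1}ᶜ, 1/2 < t ∧ t < 3/2 := by
    apply Filter.Eventually.frequently
    apply nhdsWithin_le_nhds
    exact Ioo_mem_nhds (by norm_num) (by norm_num)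
  have ht : Filter.Tendsto (fun t : ℝ => (t:ℂ)) (nhdsWithin 1 {1}ᶜ) (nhdsWithin 1 {1}ᶜ) := by
    apply tendsto_nhdsWithin_of_tendsto_nhds_of_eventually_within
    · exact (Complex.continuous_ofReal.tendsto' _ _ (by simp)).mono_left nhdsWithin_le_nhds
    · filter_upwards [self_mem_nhdsWithin] with t ht
      simpa using ht
  apply ht.frequently
  exact hfr.mono (fun t ht => key t ht.1 ht.2)

lemma digamma_hasSum {z : ℂ} (hz : 0 < z.re) :
    HasSum (fun n : ℕ => 1 / sh n - 1/((n:ℂ)+z)) (Complex.digamma z - Complex.digamma (1/2)) ∧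
    HasSum (fun n : ℕ => 1/((n:ℂ)+z)^2) (deriv Complex.digamma z) := by
  set δ := min (1/2) (z.re/2) with hδd
  set R := ‖z‖ + 2 with hRd
  have hδ : 0 < δ := lt_min (by norm_num) (by linarith)
  have hδ1 : δ ≤ 1/2 := min_le_left _ _
  have hR : 2 ≤ R := by have := norm_nonneg z; linarith
  have hm : z ∈ reg δ R := by
    constructor
    · have : δ ≤ z.re/2 := min_le_right _ _
      show δ < z.re
      linarith
    · simp [hRd]
  have heq := digamma_eqOn hδ hδ1 hR
  have hs : Summable (fun n : ℕ => 1 / sh n - 1/((n:ℂ)+z)) :=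
      Summable.of_norm_bounded (u2_summable.mul_left ((R+1)/δ)) (fun n => term_bound hδ hδ1 hm n)
  constructor
  · have := heq hm
    simp only at this
    rw [this]
    exact hs.hasSum
  · have h := Complex.hasSum_deriv_of_summable_norm (u2_summable.mul_left ((R+1)/δ)) (term_diff hδ)
      (reg_open δ R) (fun n w hw => term_bound hδ hδ1 hw n) hm
    have e1 : deriv (fun w => ∑' n : ℕ, (1 / sh n - 1/((n:ℂ)+w))) z = deriv Complex.digamma z := by
      rw [← deriv_sub_const (f := Complex.digamma) (Complex.digamma (1/2))]
      apply Filter.EventuallyEq.deriv_eq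
      filter_upwards [(reg_open δ R).mem_nhds hm] with w hw
      exact (heq hw).symm
    rw [e1] at h
    refine h.congr_fun ?_ 
    intro n
    have h0 := reg_ne hδ hm n
    have d1 : HasDerivAt (fun w : ℂ => (n:ℂ) + w) 1 z := (hasDerivAt_id z).const_add _
    have d2 := (d1.inv h0).const_sub (1 / sh n)
    simp only [one_div] at d2 ⊢
    exact (d2.deriv.trans (by ring)).symm

lemma cos_ne_of {x : ℂ} (hre : x.re < 1/2) (hp : ∀ n : ℕ, x + 1/2 ≠ -(n : ℂ)) :
    Complex.cos (Real.pi * x) ≠ 0 := by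
  rw [Complex.cos_ne_zero_iff]
  intro k h
  have hpi : (Real.pi : ℂ) ≠ 0 := by exact_mod_cast Real.pi_ne_zero
  have hx : x = (2 * k + 1) / 2 := by
    apply mul_left_cancel₀ hpi
    rw [h]; ring
  have hr : x.re = (2 * k + 1) / 2 := by
    have : x = (((2 * k + 1) / 2 : ℝ) : ℂ) := by rw [hx]; push_cast; rfl
    rw [this, Complex.ofReal_re]
  have hk : k < 0 := by
    have : (k:ℝ) < 0 := by linarith
    exact_mod_cast this
  obtain ⟨m, hm⟩ := Int.eq_ofNat_of_zero_le (by omega : 0 ≤ -k - 1)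
  apply hp m
  have hkm : (k:ℂ) = -(m:ℂ) - 1 := by
    have : k = -(m:ℤ) - 1 := by omega
    rw [this]; push_cast; ring
  rw [hx, hkm]; ring

lemma gamma_refl (x : ℂ) : Complex.Gamma (1/2 + x) * Complex.Gamma (1/2 - x) =
    Real.pi / Complex.cos (Real.pi * x) := by
  have h := Complex.Gamma_mul_Gamma_one_sub (1/2 + x)
  have e1 : 1 - (1/2 + x) = 1/2 - x := by ring
  have e2 : Real.pi * (1/2 + x) = Real.pi * x + Real.pi / 2 := by ring
  rw [e1, e2, Complex.sin_add_pi_div_two] at h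
  exact h

lemma not_pole {x : ℂ} (hc : Complex.cos (Real.pi * x) ≠ 0) :
    (∀ m : ℕ, 1/2 + x ≠ -(m:ℂ)) ∧ (∀ m : ℕ, 1/2 - x ≠ -(m:ℂ)) := by
  have hpi : (Real.pi : ℂ) ≠ 0 := by exact_mod_cast Real.pi_ne_zero
  have h : Real.pi / Complex.cos (Real.pi * x) ≠ 0 := div_ne_zero hpi hc
  rw [← gamma_refl] at h
  constructor
  · intro m hm
    apply h
    rw [hm, Complex.Gamma_neg_nat_eq_zero, zero_mul]
  · intro m hm
    apply h
    rw [hm, Complex.Gamma_neg_nat_eq_zero, mul_zero]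

lemma open_cos : IsOpen {x : ℂ | Complex.cos (Real.pi * x) ≠ 0} :=
  isOpen_ne_fun (by fun_prop) continuous_const

lemma digamma_refl {x : ℂ} (hc : Complex.cos (Real.pi * x) ≠ 0) :
    Complex.digamma (1/2 - x) = Complex.digamma (1/2 + x) - Real.pi * Complex.tan (Real.pi * x) := by
  have hpi : (Real.pi : ℂ) ≠ 0 := by exact_mod_cast Real.pi_ne_zero
  obtain ⟨n1, n2⟩ := not_pole hc
  have g1 := Complex.Gamma_ne_zero n1
  have g2 := Complex.Gamma_ne_zero n2
  have d1 := (Complex.differentiableAt_Gamma _ n1).hasDerivAt.comp x ((hasDerivAt_id x).const_add (1/2))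
  have d2 := (Complex.differentiableAt_Gamma _ n2).hasDerivAt.comp x ((hasDerivAt_id x).const_sub (1/2))
  have d3 := d1.mul d2
  have c1 : HasDerivAt (fun y : ℂ => Real.pi * y) Real.pi x := by
    simpa using (hasDerivAt_id x).const_mul (Real.pi : ℂ)
  have c2 := (Complex.hasDerivAt_cos (Real.pi * x)).comp x c1
  have d4 := d3.mul c2
  have e : (fun y : ℂ => (Complex.Gamma (1/2 + y) * Complex.Gamma (1/2 - y)) * Complex.cos (Real.pi * y)) =ᶠ[nhds x]
      (fun _ => (Real.pi : ℂ)) := by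
    filter_upwards [open_cos.mem_nhds hc] with y hy
    have hy' : Complex.cos (Real.pi * y) ≠ 0 := hy
    rw [gamma_refl]; field_simp
  have d5 := (hasDerivAt_const x (Real.pi:ℂ)).congr_of_eventuallyEq e
  have h := d4.unique d5
  simp only [Function.comp_apply, Pi.mul_apply, mul_one] at h
  rw [Complex.digamma_def, logDeriv_apply, logDeriv_apply, Complex.tan_eq_sin_div_cos]
  clear d1 d2 d3 d4 d5 c1 c2 e n1 n2
  generalize Complex.Gamma (1/2 + x) = A at *
  generalize Complex.Gamma (1/2 - x) = B at *
  generalize deriv Complex.Gamma (1/2 + x) = A' at *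
  generalize deriv Complex.Gamma (1/2 - x) = B' at *
  generalize Complex.cos (Real.pi * x) = c at *
  generalize Complex.sin (Real.pi * x) = s at *
  field_simp
  linear_combination -h

lemma trigamma_refl {x : ℂ} (hc : Complex.cos (Real.pi * x) ≠ 0) :
    deriv Complex.digamma (1/2 - x) = - deriv Complex.digamma (1/2 + x)
      + Real.pi^2 * (1 + Complex.tan (Real.pi * x)^2) := by
  obtain ⟨n1, n2⟩ := not_pole hc
  have d1 := (digamma_diff n1).hasDerivAt.comp x ((hasDerivAt_id x).const_add (1/2))
  have d2 := (digamma_diff n2).hasDerivAt.comp x ((hasDerivAt_id x).const_sub (1/2))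
  have c1 : HasDerivAt (fun y : ℂ => Real.pi * y) Real.pi x := by
    simpa using (hasDerivAt_id x).const_mul (Real.pi : ℂ)
  have c2 := ((Complex.hasDerivAt_tan hc).comp x c1).const_mul (Real.pi : ℂ)
  have d3 := d1.sub c2
  have e : (fun y : ℂ => Complex.digamma (1/2 - y)) =ᶠ[nhds x]
     (fun y : ℂ => Complex.digamma (1/2 + y) - Real.pi * Complex.tan (Real.pi * y)) := by
    filter_upwards [open_cos.mem_nhds hc] with y hy
    exact digamma_refl hy
  have h := d2.unique (d3.congr_of_eventuallyEq e)
  have ht : 1 + Complex.tan (Real.pi * x)^2 = 1 / Complex.cos (Real.pi * x)^2 := by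
    rw [Complex.tan_eq_sin_div_cos]
    field_simp
    rw [add_comm]; exact Complex.sin_sq_add_cos_sq _
  rw [ht]
  simp only [mul_one] at h
  linear_combination -h

lemma sum_inv_sq : HasSum (fun n : ℕ => 1/(sh n)^2) ((Real.pi:ℂ)^2/2) := by
  have h := (digamma_hasSum (z := 1/2) (by norm_num)).2
  have r := trigamma_refl (x := 0) (by simp)
  simp only [sub_zero, add_zero, mul_zero, Complex.tan_zero] at r
  have : deriv Complex.digamma (1/2) = (Real.pi:ℂ)^2/2 := by linear_combination r/2
  rw [this] at h
  exact h

lemma Gs_eq {x : ℂ} (hre : x.re < 1/2) (hx0 : x ≠ 0) :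
    Gs x = (Complex.digamma (1/2 - x) - Complex.digamma (1/2)) / (2 * x^3)
      + deriv Complex.digamma (1/2 - x) / (4 * x^2) + Real.pi^2 / (8 * x^2) := by
  obtain ⟨h1, h2⟩ := digamma_hasSum (z := 1/2 - x) (by simp; linarith)
  have h := ((h1.div_const (2 * x^3)).add (h2.div_const (4*x^2))).add (sum_inv_sq.div_const (4 * x^2))
  have e : (Real.pi:ℂ)^2/2/(4*x^2) = Real.pi^2 / (8 * x^2) := by field_simp; norm_num
  rw [e] at h
  rw [Gs, ← h.tsum_eq]
  apply tsum_congr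
  intro n
  have a1 := sh_ne n
  have a2 := sh_sub_ne hre n
  have e2 : (n:ℂ) + (1/2 - x) = sh n - x := by simp only [sh]; ring
  rw [e2]
  field_simp
  ring

end FG

/-- The closed form of `F(x)` in terms of digamma, trigamma and
trigonometric functions, for `Re x < 1/2`, `x ≠ 0`, `x + 1/2` not a nonpositive
integer. -/
theorem Fgen_closed_form (x : ℂ) (hre : x.re < 1/2) (hx0 : x ≠ 0)
    (hp : ∀ n : ℕ, x + 1/2 ≠ -(n : ℂ)) :
    Fgen x =
      ((Real.eulerMascheroniConstant : ℂ) + 2 * Real.log 2 + digammaC (1/2 + x)) /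
          (2 * x ^ 3)
        - trigammaC (1/2 + x) / (4 * x ^ 2)
        + 3 * (Real.pi : ℂ) ^ 2 / (8 * x ^ 2)
        - (Real.pi : ℂ) * Complex.tan (Real.pi * x) / (2 * x ^ 3)
        + (Real.pi : ℂ) ^ 2 * Complex.tan (Real.pi * x) ^ 2 / (4 * x ^ 2) := by
  have hc := FG.cos_ne_of hre hp
  have hF : Fgen x = FG.Fs x := tsum_congr (fun n => FG.Fgen_term hre hp n)
  have hd : digammaC = Complex.digamma := by
    funext z
    rw [Complex.digamma_def, logDeriv_apply, digammaC]
  have ht : trigammaC (1/2 + x) = deriv Complex.digamma (1/2 + x) := by rw [trigammaC, hd]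
  have hl : Complex.log 2 = ((Real.log 2 : ℝ) : ℂ) := by
    rw [Complex.ofReal_log (by norm_num)]; norm_num
  rw [hF, FG.Fs_eq_Gs hre hx0, FG.Gs_eq hre hx0, ht, hd, FG.digamma_refl hc, FG.trigamma_refl hc,
    Complex.digamma_one_half, hl]
  field_simp
  ring
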